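/- arXiv:2512.19640 — 5 statements merged into one kernel-verified Lean document; each statement's English description precedes it below -/
import Mathlib

section
/- Let M be a 24×24 matrix with integer entries, λ ∈ ℂ, and ψ ∈ ℂ^24 a vector such that (i) M ψ = λ ψ, and (ii) for every nonzero vector w ∈ ℂ^24 all of whose coordinates are algebraic numbers, ∑_i w_i ψ_i ≠ 0. Then M = λ·Id, and λ is an integer. -/
theorem isIntegral_of_map_intCast_mulVec_eq_smul {n K : Type*} [Fintype n] [DecidableEq n]
    [Field K] {M : Matrix n n ℤ} {μ : K} {v : n → K} (hv : v ≠ 0)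
    (h : (M.map (Int.cast : ℤ → K)).mulVec v = μ • v) : IsIntegral ℤ μ := by
  refine ⟨M.charpoly, M.charpoly_monic, ?_⟩
  rw [← Polynomial.eval_map, ← Matrix.charpoly_map, Matrix.eval_charpoly,
    ← Matrix.exists_mulVec_eq_zero_iff]
  refine ⟨v, hv, ?_⟩
  rw [Matrix.sub_mulVec, Matrix.scalar_apply, sub_eq_zero]
  refine Eq.trans ?_ h.symm
  ext i
  simp [Matrix.mulVec_diagonal]

/-- If a `24 × 24` integer matrix `M` has an eigenvector `ψ` (eigenvalue `lam`)
which is not orthogonal to any nonzero vector with algebraic coordinates, then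
`M = lam • Id` and `lam` is an integer. -/
theorem stmt5 (M : Matrix (Fin 24) (Fin 24) ℤ) (lam : ℂ) (ψ : Fin 24 → ℂ)
    (heig : (M.map (Int.cast : ℤ → ℂ)).mulVec ψ = lam • ψ)
    (hgen : ∀ w : Fin 24 → ℂ, w ≠ 0 → (∀ i, IsAlgebraic ℚ (w i)) →
      ∑ i, w i * ψ i ≠ 0) :
    M.map (Int.cast : ℤ → ℂ) = lam • (1 : Matrix (Fin 24) (Fin 24) ℂ) ∧
      ∃ n : ℤ, lam = (n : ℂ) := by
  have hψ : ψ ≠ 0 := by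
    rintro rfl
    exact hgen 1 one_ne_zero (fun _ => isAlgebraic_one) (by simp)
  have hlam : IsAlgebraic ℚ lam :=
    (isIntegral_of_map_intCast_mulVec_eq_smul hψ heig).isAlgebraic.extendScalars
      (Int.cast_injective (α := ℚ))
  have hM : M.map (Int.cast : ℤ → ℂ) = lam • (1 : Matrix (Fin 24) (Fin 24) ℂ) := by
    rw [← sub_eq_zero]
    refine funext fun i => ?_
    by_contra hrow
    refine hgen _ hrow (fun j => ?_) ?_
    · have hone : IsAlgebraic ℚ ((1 : Matrix (Fin 24) (Fin 24) ℂ) i j) := by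
        rw [Matrix.one_apply]
        split_ifs
        exacts [isAlgebraic_one, isAlgebraic_zero]
      exact (isAlgebraic_intCast (M i j)).sub (hlam.mul hone)
    · change ((M.map (Int.cast : ℤ → ℂ) - lam • 1).mulVec ψ) i = 0
      rw [Matrix.sub_mulVec, heig, Matrix.smul_mulVec, Matrix.one_mulVec, sub_self, Pi.zero_apply]
  exact ⟨hM, M 0 0, by simpa using (congrFun (congrFun hM 0) 0).symm⟩
end

section
/- Let k ≥ 1 be an integer and define, for integers 0 ≤ l, l' ≤ k and m, m' ∈ ℤ, the complex number S^k_{lm;l'm'} = (2/(k+2))·sin(π(l+1)(l'+1)/(k+2))·exp(πi·m·m'/(k+2)). Then for every 0 ≤ l' ≤ k and all integers m, m' one has S^k_{l'm';00} ≠ 0 and S^k_{l'm';km} / S^k_{l'm';00} = (−1)^{l'}·exp(πi·m·m'/(k+2)). -/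
/-- The modular S-matrix of the `N=2` superconformal minimal model at level `k`:
`S^k_{lm;l'm'} = (2/(k+2))·sin(π(l+1)(l'+1)/(k+2))·exp(πi·m·m'/(k+2))`. -/
noncomputable def Smat (k l : ℕ) (m : ℤ) (l' : ℕ) (m' : ℤ) : ℂ :=
  (((2 / ((k : ℝ) + 2)) *
      Real.sin (Real.pi * ((l : ℝ) + 1) * ((l' : ℝ) + 1) / ((k : ℝ) + 2)) : ℝ) : ℂ) *
    Complex.exp ((Real.pi : ℂ) * Complex.I * (m : ℂ) * (m' : ℂ) / ((k : ℂ) + 2))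

/-- Reflection of the sine factor of the S-matrix under the simple current `l ↦ k - l`. -/
theorem sin_reflect (k l : ℕ) :
    Real.sin (Real.pi * ((l : ℝ) + 1) * ((k : ℝ) + 1) / ((k : ℝ) + 2)) =
      (-1) ^ l * Real.sin (Real.pi * ((l : ℝ) + 1) / ((k : ℝ) + 2)) := by
  have hk : (k : ℝ) + 2 ≠ 0 := by positivity
  have h : Real.pi * ((l : ℝ) + 1) * ((k : ℝ) + 1) / ((k : ℝ) + 2) =
      ((l + 1 : ℕ) : ℝ) * Real.pi - Real.pi * ((l : ℝ) + 1) / ((k : ℝ) + 2) := by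
    push_cast
    field_simp
    ring
  rw [h, Real.sin_nat_mul_pi_sub, pow_succ]
  ring

/-- The vacuum column of the S-matrix has nonvanishing sine factor. -/
theorem sin_vacuum_pos {k l : ℕ} (hl : l ≤ k) :
    0 < Real.sin (Real.pi * ((l : ℝ) + 1) / ((k : ℝ) + 2)) := by
  have hlk : (l : ℝ) ≤ k := by exact_mod_cast hl
  apply Real.sin_pos_of_pos_of_lt_pi
  · positivity
  · rw [div_lt_iff₀ (by positivity)]
    exact mul_lt_mul_of_pos_left (by linarith) Real.pi_pos

theorem Smat_vacuum (k l : ℕ) (m : ℤ) :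
    Smat k l m 0 0 =
      ((2 / ((k : ℝ) + 2) * Real.sin (Real.pi * ((l : ℝ) + 1) / ((k : ℝ) + 2)) : ℝ) : ℂ) := by
  simp [Smat]

/-- The invertible Verlinde lines `L^k_{km}` of the level-`k` `N=2` minimal
model act on the primary `|l',m'⟩` with eigenvalue
`S^k_{l'm';km}/S^k_{l'm';00} = (-1)^{l'}·exp(πi·m·m'/(k+2))`. -/
theorem stmt13 (k : ℕ) (hk : 1 ≤ k) (l' : ℕ) (hl' : l' ≤ k) (m m' : ℤ) :
    Smat k l' m' 0 0 ≠ 0 ∧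
      Smat k l' m' k m / Smat k l' m' 0 0 =
        (-1 : ℂ) ^ l' *
          Complex.exp ((Real.pi : ℂ) * Complex.I * (m : ℂ) * (m' : ℂ) / ((k : ℂ) + 2)) := by
  have hS : Smat k l' m' 0 0 ≠ 0 := by
    rw [Smat_vacuum, Complex.ofReal_ne_zero]
    exact mul_ne_zero (by positivity) (sin_vacuum_pos hl').ne'
  refine ⟨hS, ?_⟩
  rw [div_eq_iff hS, Smat_vacuum, Smat, sin_reflect, mul_right_comm _ (m' : ℂ) (m : ℂ)]
  push_cast
  ring
end

section
/- Let n ≥ 1 and let G = (ℤ/n × ℤ/n) ⋊ ℤ/2 be the semidirect product in which the nontrivial element of ℤ/2 acts on ℤ/n × ℤ/n by swapping the two coordinates, and let H ≤ G be the subgroup {((0,b), 0) : b ∈ ℤ/n} ≅ ℤ/n. Write a = ((1,0), 0) and g = ((0,0), 1). Then the double coset space H\G/H consists of exactly n + 1 double cosets: the n pairwise distinct double cosets H aᵏ H for k = 0, …, n−1, each of cardinality n, and the double coset H g H, of cardinality n². -/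
/-- `ℤ/n × ℤ/n`, written multiplicatively. -/
abbrev Kgrp (n : ℕ) := Multiplicative (ZMod n) × Multiplicative (ZMod n)

/-- The coordinate-swap automorphism of `ℤ/n × ℤ/n`. -/
def swapAut (n : ℕ) : MulAut (Kgrp n) :=
  (MulEquiv.prodComm : Kgrp n ≃* Kgrp n)

/-- The action of `ℤ/2` on `ℤ/n × ℤ/n` whose nontrivial element swaps the two
coordinates. -/
def swapHom (n : ℕ) : Multiplicative (ZMod 2) →* MulAut (Kgrp n) :=
  MonoidHom.mk' (fun g => if Multiplicative.toAdd g = 0 then 1 else swapAut n) (by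
    have hs : swapAut n * swapAut n = 1 := MulEquiv.ext fun _ => rfl
    have h2 : ∀ x : ZMod 2, x = 0 ∨ x = 1 := by decide
    intro a b
    have hadd : Multiplicative.toAdd (a * b) =
        Multiplicative.toAdd a + Multiplicative.toAdd b := rfl
    rcases h2 (Multiplicative.toAdd a) with ha | ha <;>
      rcases h2 (Multiplicative.toAdd b) with hb | hb <;>
      simp [hadd, ha, hb, hs, show (1 + 1 : ZMod 2) = 0 by decide,
        show (1 : ZMod 2) ≠ 0 by decide])

/-- The semidirect product `G = (ℤ/n × ℤ/n) ⋊ ℤ/2` in which the nontrivial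
element of `ℤ/2` acts by swapping the two coordinates. -/
abbrev Ggrp (n : ℕ) := Kgrp n ⋊[swapHom n] Multiplicative (ZMod 2)

/-- The element `a = ((1,0),0)` of `(ℤ/n × ℤ/n) ⋊ ℤ/2` (written multiplicatively). -/
def aElem (n : ℕ) : Ggrp n :=
  SemidirectProduct.inl (Multiplicative.ofAdd (1 : ZMod n), 1)

/-- The element `g = ((0,0),1)` of `(ℤ/n × ℤ/n) ⋊ ℤ/2` (written multiplicatively). -/
def gElem (n : ℕ) : Ggrp n :=
  SemidirectProduct.inr (Multiplicative.ofAdd (1 : ZMod 2))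

/-- The subgroup `H = {((0,b),0) : b ∈ ℤ/n} ≅ ℤ/n`. -/
def Hsub (n : ℕ) : Subgroup (Ggrp n) :=
  ((SemidirectProduct.inl : Kgrp n →* Ggrp n).comp
    (MonoidHom.inr (Multiplicative (ZMod n)) (Multiplicative (ZMod n)))).range

/-- The double coset `H x H`. -/
def dosetHH (n : ℕ) (x : Ggrp n) : Set (Ggrp n) :=
  {y | ∃ h₁ ∈ Hsub n, ∃ h₂ ∈ Hsub n, y = h₁ * x * h₂}

theorem swapHom_ofAdd_one_apply (n : ℕ) (m : Kgrp n) :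
    swapHom n (Multiplicative.ofAdd 1) m = m.swap :=
  rfl

theorem gElem_mul_inl (n : ℕ) (m : Kgrp n) :
    gElem n * SemidirectProduct.inl m = SemidirectProduct.inl m.swap * gElem n := by
  ext1 <;> simp [gElem, swapHom_ofAdd_one_apply]

theorem aElem_pow (n k : ℕ) :
    aElem n ^ k = SemidirectProduct.inl (Multiplicative.ofAdd (k : ZMod n), 1) := by
  rw [aElem, ← map_pow, Prod.pow_mk, one_pow, ← ofAdd_nsmul, nsmul_one]

theorem dosetHH_inl (n : ℕ) (m : Kgrp n) :
    dosetHH n (SemidirectProduct.inl m) =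
      Set.range fun b : Multiplicative (ZMod n) => SemidirectProduct.inl (m.1, b) := by
  ext y
  constructor
  · rintro ⟨_, ⟨b, rfl⟩, _, ⟨c, rfl⟩, rfl⟩
    refine ⟨b * m.2 * c, ?_⟩
    simp [← map_mul, Prod.mul_def]
  · rintro ⟨b, rfl⟩
    refine ⟨_, ⟨b * m.2⁻¹, rfl⟩, 1, one_mem _, ?_⟩
    simp [← map_mul, Prod.mul_def]

theorem dosetHH_gElem (n : ℕ) :
    dosetHH n (gElem n) = Set.range fun m : Kgrp n => SemidirectProduct.inl m * gElem n := by
  ext y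
  constructor
  · rintro ⟨_, ⟨b, rfl⟩, _, ⟨c, rfl⟩, rfl⟩
    refine ⟨(c, b), ?_⟩
    simp [mul_assoc, gElem_mul_inl]
    simp [← mul_assoc, ← map_mul, Prod.mul_def]
  · rintro ⟨m, rfl⟩
    refine ⟨_, ⟨m.2, rfl⟩, _, ⟨m.1, rfl⟩, ?_⟩
    simp [mul_assoc, gElem_mul_inl]
    simp [← mul_assoc, ← map_mul, Prod.mul_def]

theorem inl_mem_dosetHH_aElem_pow_iff {n k : ℕ} {m : Kgrp n} :
    SemidirectProduct.inl m ∈ dosetHH n (aElem n ^ k) ↔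
      m.1 = Multiplicative.ofAdd (k : ZMod n) := by
  rw [aElem_pow, dosetHH_inl]
  simp [Prod.ext_iff, eq_comm]

theorem mem_dosetHH_gElem_iff {n : ℕ} {x : Ggrp n} :
    x ∈ dosetHH n (gElem n) ↔ x.right = Multiplicative.ofAdd 1 := by
  rw [dosetHH_gElem]
  constructor
  · rintro ⟨m, rfl⟩
    simp [gElem]
  · intro hx
    exact ⟨x.left, by ext1 <;> simp [gElem, hx]⟩

/-- The double coset space `H\G/H` for `G = (ℤ/n × ℤ/n) ⋊ ℤ/2` and
`H = {((0,b),0)}` consists of exactly `n + 1` double cosets: the `n` pairwise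
distinct double cosets `H aᵏ H` (`k = 0, …, n-1`), each of cardinality `n`,
and the double coset `H g H`, of cardinality `n²`. -/
theorem stmt15 (n : ℕ) (hn : 0 < n) :
    (∀ k < n, (dosetHH n (aElem n ^ k)).ncard = n) ∧
      (∀ k < n, ∀ l < n, dosetHH n (aElem n ^ k) = dosetHH n (aElem n ^ l) → k = l) ∧
      (dosetHH n (gElem n)).ncard = n ^ 2 ∧
      (∀ k < n, dosetHH n (aElem n ^ k) ≠ dosetHH n (gElem n)) ∧
      (∀ x : Ggrp n,
        (∃ k < n, x ∈ dosetHH n (aElem n ^ k)) ∨ x ∈ dosetHH n (gElem n)) := by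
  have : NeZero n := ⟨hn.ne'⟩
  refine ⟨fun k _ => ?_, fun k hk l hl h => ?_, ?_, fun k _ h => ?_, fun x => ?_⟩
  · rw [aElem_pow, dosetHH_inl, Set.ncard_range_of_injective]
    · simp
    · exact SemidirectProduct.inl_injective.comp (Prod.mk_right_injective _)
  · have hmem : SemidirectProduct.inl (Multiplicative.ofAdd (k : ZMod n), 1) ∈
        dosetHH n (aElem n ^ l) :=
      h ▸ inl_mem_dosetHH_aElem_pow_iff.mpr rfl
    have hkl : (k : ZMod n) = l := inl_mem_dosetHH_aElem_pow_iff.mp hmem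
    rw [← ZMod.val_cast_of_lt hk, hkl, ZMod.val_cast_of_lt hl]
  · rw [dosetHH_gElem, Set.ncard_range_of_injective]
    · simp [sq]
    · exact (mul_left_injective _).comp SemidirectProduct.inl_injective
  · have hmem : SemidirectProduct.inl (Multiplicative.ofAdd (k : ZMod n), 1) ∈
        dosetHH n (gElem n) :=
      h ▸ inl_mem_dosetHH_aElem_pow_iff.mpr rfl
    have h01 : (0 : ZMod 2) = 1 := mem_dosetHH_gElem_iff.mp hmem
    exact absurd h01 (by decide)
  · have h2 : ∀ i : ZMod 2, i = 0 ∨ i = 1 := by decide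
    rcases h2 x.right.toAdd with hx | hx
    · refine Or.inl ⟨x.left.1.toAdd.val, ZMod.val_lt _, ?_⟩
      have hxl : x = SemidirectProduct.inl x.left := SemidirectProduct.ext rfl hx
      rw [hxl, inl_mem_dosetHH_aElem_pow_iff]
      simp
    · exact Or.inr (mem_dosetHH_gElem_iff.mpr hx)
end

section
/- Let A = ℤ/2 × ℤ/2 and let χ : A × A → ℂ∖{0} be symmetric (χ(x,y) = χ(y,x)), bimultiplicative (χ(x+y,z) = χ(x,z)·χ(y,z) for all x, y, z, and similarly in the second argument), and nondegenerate (if χ(x,y) = 1 for all y ∈ A then x = 0). Define, for x = (x₁,x₂) and y = (y₁,y₂) in A with coordinates lifted to {0,1}, the bicharacters χₐ(x,y) = (−1)^{x₁y₂ + x₂y₁} and χₛ(x,y) = (−1)^{x₁y₂ + x₂y₁ + x₁y₁}. Then there exists a group automorphism φ of A such that either χ(φ(x),φ(y)) = χₐ(x,y) for all x, y, or χ(φ(x),φ(y)) = χₛ(x,y) for all x, y. -/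
/-- The bicharacter `χₐ(x,y) = (-1)^(x₁y₂+x₂y₁)` on `ℤ/2 × ℤ/2` (coordinates
lifted to `{0,1}`). -/
def chiA (x y : ZMod 2 × ZMod 2) : ℂ :=
  (-1 : ℂ) ^ (x.1.val * y.2.val + x.2.val * y.1.val)

/-- The bicharacter `χₛ(x,y) = (-1)^(x₁y₂+x₂y₁+x₁y₁)` on `ℤ/2 × ℤ/2`. -/
def chiS (x y : ZMod 2 × ZMod 2) : ℂ :=
  (-1 : ℂ) ^ (x.1.val * y.2.val + x.2.val * y.1.val + x.1.val * y.1.val)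

/-- Two distinct nonzero elements of `ℤ/2 × ℤ/2` are the images of the standard basis under an
automorphism. -/
theorem exists_addEquiv_eq_smul_add_smul {a q : ZMod 2 × ZMod 2}
    (ha : a ≠ 0) (hq : q ≠ 0) (haq : a ≠ q) :
    ∃ φ : (ZMod 2 × ZMod 2) ≃+ (ZMod 2 × ZMod 2), ∀ x, φ x = x.1 • a + x.2 • q := by
  have key : ∀ a q : ZMod 2 × ZMod 2, a ≠ 0 → q ≠ 0 → a ≠ q →
      Function.Bijective fun x : ZMod 2 × ZMod 2 => x.1 • a + x.2 • q := by decide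
  refine ⟨AddEquiv.ofBijective (AddMonoidHom.mk' (fun x => x.1 • a + x.2 • q) fun x y => ?_)
    (key a q ha hq haq), fun x => rfl⟩
  simp only [Prod.fst_add, Prod.snd_add, add_smul]
  abel

/-- Every symmetric nondegenerate bicharacter on `ℤ/2 × ℤ/2` with values in
`ℂ∖{0}` is equivalent, via a group automorphism, to `χₐ` or to `χₛ`. -/
theorem stmt18 (χ : ZMod 2 × ZMod 2 → ZMod 2 × ZMod 2 → ℂ)
    (hne : ∀ x y, χ x y ≠ 0)
    (hsymm : ∀ x y, χ x y = χ y x)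
    (hmul₁ : ∀ x y z, χ (x + y) z = χ x z * χ y z)
    (hmul₂ : ∀ x y z, χ z (x + y) = χ z x * χ z y)
    (hnd : ∀ x, (∀ y, χ x y = 1) → x = 0) :
    ∃ φ : (ZMod 2 × ZMod 2) ≃+ (ZMod 2 × ZMod 2),
      (∀ x y, χ (φ x) (φ y) = chiA x y) ∨ (∀ x y, χ (φ x) (φ y) = chiS x y) := by
  have h0l (y) : χ 0 y = 1 := by
    have h := hmul₁ 0 0 y
    rw [add_zero] at h
    exact (mul_eq_left₀ (hne 0 y)).mp h.symm
  have h0r (x) : χ x 0 = 1 := by rw [hsymm, h0l]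
  have hsign (x y) : χ x y = 1 ∨ χ x y = -1 := by
    rw [← mul_self_eq_one_iff, ← hmul₁, CharTwo.add_self_eq_zero, h0l]
  obtain ⟨q, hq, hqq⟩ : ∃ q, q ≠ 0 ∧ χ q q = 1 := by
    by_contra! H
    have h₁ := (hsign _ _).resolve_left (H (1, 0) (by decide))
    have h₂ := (hsign _ _).resolve_left (H (0, 1) (by decide))
    apply H ((1, 0) + (0, 1)) (by decide)
    rw [hmul₁, hmul₂, hmul₂, h₁, h₂, hsymm (0, 1) (1, 0)]
    rcases hsign (1, 0) (0, 1) with h | h <;> rw [h] <;> norm_num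
  obtain ⟨a, haq⟩ : ∃ a, χ q a ≠ 1 := by
    by_contra! H
    exact hq (hnd q H)
  obtain ⟨φ, hφ⟩ := exists_addEquiv_eq_smul_add_smul
    (a := a) (q := q) (by rintro rfl; exact haq (h0r q)) hq (by rintro rfl; exact haq hqq)
  have hqa := (hsign q a).resolve_left haq
  have haq' : χ a q = -1 := by rw [hsymm, hqa]
  have hz : ∀ z : ZMod 2, z = 0 ∨ z = 1 := by decide
  refine ⟨φ, (hsign a a).imp (fun haa => ?_) (fun haa => ?_)⟩ <;>
  · rintro ⟨x₁, x₂⟩ ⟨y₁, y₂⟩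
    rw [hφ, hφ, hmul₁, hmul₂, hmul₂]
    obtain rfl | rfl := hz x₁ <;> obtain rfl | rfl := hz x₂ <;>
      obtain rfl | rfl := hz y₁ <;> obtain rfl | rfl := hz y₂ <;>
      simp [chiA, chiS, h0l, h0r, haa, hqa, haq', hqq, ZMod.val_one, pow_succ]
end

section
/- Fix an integer k ≥ 1 and let P_k = {(l,m) ∈ ℤ × ℤ : 0 ≤ l ≤ k, |m| ≤ l, and m ≡ l (mod 2)}. Define σ : P_k → P_k by σ(l,m) = (l, m+2) if m ≤ l−2, and σ(l,m) = (k−l, m−k) if m > l−2. Then σ is a well-defined permutation of P_k of order exactly k+2, and for every natural number j and every (l,m) ∈ P_k, σ^j(l,m) = (l,m) if and only if (k+2) divides j, or (k+2) divides 2j and 2l = k. -/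
/-- The set of NS-sector labels `(l,m)` of the level-`k` `N=2` minimal model:
`0 ≤ l ≤ k`, `|m| ≤ l` and `m ≡ l (mod 2)`. -/
def GepnerP (k : ℕ) : Set (ℤ × ℤ) :=
  {p | 0 ≤ p.1 ∧ p.1 ≤ (k : ℤ) ∧ |p.2| ≤ p.1 ∧ (2 : ℤ) ∣ (p.1 - p.2)}

/-- One unit of spectral flow on minimal model labels. -/
def spectralFlow (k : ℕ) (p : ℤ × ℤ) : ℤ × ℤ :=
  if p.2 ≤ p.1 - 2 then (p.1, p.2 + 2) else ((k : ℤ) - p.1, p.2 - (k : ℤ))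

/-- Every label has the form `(l, l - 2a)` with `0 ≤ a ≤ l ≤ k`. -/
lemma exists_of_mem_gepnerP {k : ℕ} {p : ℤ × ℤ} (hp : p ∈ GepnerP k) :
    ∃ l a : ℕ, a ≤ l ∧ l ≤ k ∧ p = ((l : ℤ), (l : ℤ) - 2 * a) := by
  obtain ⟨x, y⟩ := p
  obtain ⟨h0, hk, habs, c, hc⟩ := hp
  dsimp only at h0 hk habs hc
  rw [abs_le] at habs
  refine ⟨x.toNat, c.toNat, by omega, by omega, ?_⟩
  ext <;> dsimp only <;> omega

/-- Closed form for the first `k + 2` iterates of the spectral flow. -/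
lemma spectralFlow_iterate {k l a : ℕ} (hlk : l ≤ k) (r : ℕ) (hr : r ≤ k + 2) :
    (spectralFlow k)^[r] ((l : ℤ), (l : ℤ) - 2 * a) =
      if r ≤ a then ((l : ℤ), (l : ℤ) - 2 * a + 2 * r)
      else if r + l ≤ a + 1 + k then ((k : ℤ) - l, (l : ℤ) - k + 2 * ((r : ℤ) - a - 1))
      else ((l : ℤ), (l : ℤ) + 2 * ((r : ℤ) - a - k - 2)) := by
  induction r with
  | zero => simp
  | succ r ih =>
    rw [Function.iterate_succ_apply', ih (by omega)]
    unfold spectralFlow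
    split_ifs <;> ext <;> dsimp only at * <;> omega

lemma spectralFlow_mapsTo (k : ℕ) :
    Set.MapsTo (spectralFlow k) (GepnerP k) (GepnerP k) := by
  rintro ⟨x, y⟩ ⟨h0, hk, habs, hdvd⟩
  dsimp only at h0 hk habs hdvd
  rw [abs_le] at habs
  unfold spectralFlow GepnerP
  split_ifs <;> simp only [Set.mem_ofPred_eq, abs_le] at * <;> omega

lemma spectralFlow_iterate_period {k : ℕ} {p : ℤ × ℤ} (hp : p ∈ GepnerP k) :
    (spectralFlow k)^[k + 2] p = p := by
  obtain ⟨l, a, hal, hlk, rfl⟩ := exists_of_mem_gepnerP hp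
  rw [spectralFlow_iterate hlk _ le_rfl]
  split_ifs <;> ext <;> dsimp only <;> omega

lemma spectralFlow_bijOn (k : ℕ) :
    Set.BijOn (spectralFlow k) (GepnerP k) (GepnerP k) := by
  refine Set.InvOn.bijOn (f' := (spectralFlow k)^[k + 1]) ⟨fun p hp => ?_, fun p hp => ?_⟩
    (spectralFlow_mapsTo k) ((spectralFlow_mapsTo k).iterate _)
  · rw [← Function.iterate_succ_apply]
    exact spectralFlow_iterate_period hp
  · rw [← Function.iterate_succ_apply' (spectralFlow k)]
    exact spectralFlow_iterate_period hp

lemma spectralFlow_iterate_eq_self_iff {k : ℕ} (j : ℕ) {p : ℤ × ℤ} (hp : p ∈ GepnerP k) :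
    (spectralFlow k)^[j] p = p ↔
      (k + 2) ∣ j ∨ ((k + 2) ∣ 2 * j ∧ 2 * p.1 = (k : ℤ)) := by
  have hper : Function.IsPeriodicPt (spectralFlow k) (k + 2) p := spectralFlow_iterate_period hp
  have hlt : j % (k + 2) < k + 2 := Nat.mod_lt _ (by omega)
  rw [← hper.iterate_mod_apply j, Nat.dvd_iff_mod_eq_zero,
    ← (Nat.ModEq.mul_left 2 (Nat.mod_modEq j (k + 2))).dvd_iff dvd_rfl]
  generalize j % (k + 2) = r at hlt
  obtain ⟨l, a, hal, hlk, rfl⟩ := exists_of_mem_gepnerP hp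
  have hdvd : (k + 2) ∣ 2 * r ↔ r = 0 ∨ 2 * r = k + 2 := by
    constructor
    · rintro ⟨c, hc⟩
      have hc2 : c < 2 := by
        by_contra! h
        nlinarith
      interval_cases c <;> omega
    · rintro (rfl | h)
      · simp
      · rw [h]
  rw [hdvd, spectralFlow_iterate hlk r hlt.le]
  split_ifs <;> rw [Prod.mk.injEq] <;> dsimp only <;> omega

/-- Spectral flow `σ` is a well-defined permutation of the label set `P_k`, of
order exactly `k+2`, and `σ^j` fixes `(l,m) ∈ P_k` iff `(k+2) ∣ j`, or
`(k+2) ∣ 2j` and `2l = k`. -/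
theorem stmt19 (k : ℕ) (hk : 1 ≤ k) :
    Set.MapsTo (spectralFlow k) (GepnerP k) (GepnerP k) ∧
      Set.BijOn (spectralFlow k) (GepnerP k) (GepnerP k) ∧
      (∀ p ∈ GepnerP k, (spectralFlow k)^[k + 2] p = p) ∧
      (∀ j : ℕ, 0 < j → j < k + 2 → ∃ p ∈ GepnerP k, (spectralFlow k)^[j] p ≠ p) ∧
      (∀ j : ℕ, ∀ p ∈ GepnerP k, ((spectralFlow k)^[j] p = p ↔
        (k + 2) ∣ j ∨ ((k + 2) ∣ 2 * j ∧ 2 * p.1 = (k : ℤ)))) := by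
  have hfix := fun (j : ℕ) (p : ℤ × ℤ) (hp : p ∈ GepnerP k) =>
    spectralFlow_iterate_eq_self_iff j hp
  refine ⟨spectralFlow_mapsTo k, spectralFlow_bijOn k,
    fun p hp => spectralFlow_iterate_period hp, fun j hj0 hjk => ?_, hfix⟩
  have h0 : ((0, 0) : ℤ × ℤ) ∈ GepnerP k := by simp [GepnerP]
  refine ⟨(0, 0), h0, fun h => ?_⟩
  rcases (hfix j _ h0).1 h with h | ⟨-, h⟩
  · exact absurd (Nat.le_of_dvd hj0 h) (by omega)
  · dsimp only at h
    omega
end
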